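/- Theorem 1 (stationarity of the Dynamic Spike-and-Slab process, process form). Let 0<Θ<1, λ₀>0, λ₁>0, φ₀∈ℝ and |φ₁|<1, and let {β_t}_{t≥0} be a time-homogeneous Markov chain on ℝ whose transition law has density K(β'|β) with respect to Lebesgue measure and whose initial state β₀ has density π^ST. Then for every t≥0 the marginal law of β_t has density π^ST(β) = Θ·ψ₁ST(β) + (1−Θ)·ψ₀(β|λ₀) with respect to Lebesgue measure. -/

import Mathlib

open MeasureTheory Real

/-- Laplace density with rate `lam`. -/
noncomputable def laplacePdf (lam β : ℝ) : ℝ := (lam / 2) * Real.exp (-(lam * |β|))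

/-- Gaussian density with mean `m` and variance `v`. -/
noncomputable def gaussPdf (m v β : ℝ) : ℝ :=
  (1 / Real.sqrt (2 * Real.pi * v)) * Real.exp (-((β - m) ^ 2) / (2 * v))

/-- Stationary slab density: Gaussian with mean `φ0` and variance `λ1/(1-φ1²)`. -/
noncomputable def psi1ST (l1 φ0 φ1 β : ℝ) : ℝ := gaussPdf φ0 (l1 / (1 - φ1 ^ 2)) β

/-- Evolving mixing weight `θ(β)`. -/
noncomputable def mixW (Θ l0 l1 φ0 φ1 β : ℝ) : ℝ :=
  Θ * psi1ST l1 φ0 φ1 β / (Θ * psi1ST l1 φ0 φ1 β + (1 - Θ) * laplacePdf l0 β)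

/-- DSS transition density `K(β'|β)`. -/
noncomputable def dssK (Θ l0 l1 φ0 φ1 β' β : ℝ) : ℝ :=
  (1 - mixW Θ l0 l1 φ0 φ1 β) * laplacePdf l0 β' +
    mixW Θ l0 l1 φ0 φ1 β * gaussPdf (φ0 + φ1 * (β - φ0)) l1 β'

/-- DSS stationary (spike-and-slab) marginal density `π^ST(β)`. -/
noncomputable def dssPiST (Θ l0 l1 φ0 φ1 β : ℝ) : ℝ :=
  Θ * psi1ST l1 φ0 φ1 β + (1 - Θ) * laplacePdf l0 β

lemma laplacePdf_nonneg {lam : ℝ} (h : 0 < lam) (β : ℝ) : 0 ≤ laplacePdf lam β := by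
  unfold laplacePdf; positivity

lemma laplacePdf_pos {lam : ℝ} (h : 0 < lam) (β : ℝ) : 0 < laplacePdf lam β := by
  unfold laplacePdf; positivity

lemma gaussPdf_nonneg (m v β : ℝ) : 0 ≤ gaussPdf m v β := by
  unfold gaussPdf; positivity

@[fun_prop]
lemma measurable_laplacePdf (lam : ℝ) : Measurable (laplacePdf lam) := by
  unfold laplacePdf; fun_prop

@[fun_prop]
lemma measurable_gaussPdf {α : Type*} [MeasurableSpace α] {f g : α → ℝ} (v : ℝ)
    (hf : Measurable f) (hg : Measurable g) : Measurable fun a => gaussPdf (f a) v (g a) := by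
  unfold gaussPdf; fun_prop

lemma lintegral_gaussPdf (m : ℝ) {v : ℝ} (hv : 0 < v) :
    ∫⁻ x, ENNReal.ofReal (gaussPdf m v x) = 1 := by
  rw [← ProbabilityTheory.lintegral_gaussianPDFReal_eq_one m (v := ⟨v, hv.le⟩)
    (fun h => hv.ne' (congrArg NNReal.toReal h))]
  simp only [gaussPdf, ProbabilityTheory.gaussianPDFReal, one_div]
  rfl

lemma lintegral_laplacePdf {lam : ℝ} (h : 0 < lam) :
    ∫⁻ x, ENNReal.ofReal (laplacePdf lam x) = 1 := by
  have hIoi : ∫ x in Set.Ioi (0 : ℝ), laplacePdf lam x = 1 / 2 := by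
    have hcongr : ∫ x in Set.Ioi (0 : ℝ), laplacePdf lam x
        = ∫ x in Set.Ioi (0 : ℝ), lam / 2 * Real.exp (-lam * x) := by
      refine setIntegral_congr_fun measurableSet_Ioi fun x hx => ?_
      simp [laplacePdf, abs_of_pos (Set.mem_Ioi.1 hx)]
    rw [hcongr, integral_const_mul, integral_exp_mul_Ioi (neg_lt_zero.2 h)]
    simp
    field_simp
  have hint : ∫ x, laplacePdf lam x = 1 := by
    have habs := integral_comp_abs (f := laplacePdf lam)
    simp only [laplacePdf, abs_abs] at habs hIoi ⊢
    rw [habs, hIoi]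
    norm_num
  have hI : Integrable (laplacePdf lam) := by
    by_contra hn
    rw [integral_undef hn] at hint
    exact zero_ne_one hint
  rw [← ofReal_integral_eq_lintegral_ofReal hI (ae_of_all _ (laplacePdf_nonneg h)), hint,
    ENNReal.ofReal_one]

/-- Detailed balance of the Gaussian autoregression with respect to its stationary density. -/
lemma psi1ST_mul_gaussPdf_comm {l1 φ0 φ1 : ℝ} (hl1 : 0 < l1) (hφ1 : |φ1| < 1) (x y : ℝ) :
    psi1ST l1 φ0 φ1 x * gaussPdf (φ0 + φ1 * (x - φ0)) l1 y =
      psi1ST l1 φ0 φ1 y * gaussPdf (φ0 + φ1 * (y - φ0)) l1 x := by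
  have h1 : 1 - φ1 ^ 2 ≠ 0 := (sub_pos.2 ((sq_lt_one_iff_abs_lt_one φ1).2 hφ1)).ne'
  simp only [psi1ST, gaussPdf]
  rw [mul_mul_mul_comm, mul_mul_mul_comm _ (Real.exp _), ← Real.exp_add, ← Real.exp_add]
  congr 2
  field_simp
  ring

lemma dssPiST_pos {Θ l0 : ℝ} (hΘ0 : 0 < Θ) (hΘ1 : Θ < 1) (hl0 : 0 < l0) (l1 φ0 φ1 β : ℝ) :
    0 < dssPiST Θ l0 l1 φ0 φ1 β :=
  add_pos_of_nonneg_of_pos (mul_nonneg hΘ0.le (gaussPdf_nonneg _ _ _))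
    (mul_pos (sub_pos.2 hΘ1) (laplacePdf_pos hl0 β))

lemma dssPiST_mul_dssK {Θ l0 l1 φ0 φ1 : ℝ} (hΘ0 : 0 < Θ) (hΘ1 : Θ < 1) (hl0 : 0 < l0)
    (hl1 : 0 < l1) (hφ1 : |φ1| < 1) (β β' : ℝ) :
    dssPiST Θ l0 l1 φ0 φ1 β * dssK Θ l0 l1 φ0 φ1 β' β =
      Θ * psi1ST l1 φ0 φ1 β' * gaussPdf (φ0 + φ1 * (β' - φ0)) l1 β +
        (1 - Θ) * laplacePdf l0 β' * laplacePdf l0 β := by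
  have hθ : dssPiST Θ l0 l1 φ0 φ1 β * mixW Θ l0 l1 φ0 φ1 β = Θ * psi1ST l1 φ0 φ1 β :=
    mul_div_cancel₀ _ (dssPiST_pos hΘ0 hΘ1 hl0 l1 φ0 φ1 β).ne'
  have hπ : dssPiST Θ l0 l1 φ0 φ1 β = Θ * psi1ST l1 φ0 φ1 β + (1 - Θ) * laplacePdf l0 β := rfl
  unfold dssK
  linear_combination (gaussPdf (φ0 + φ1 * (β - φ0)) l1 β' - laplacePdf l0 β') * hθ
    + laplacePdf l0 β' * hπ + Θ * psi1ST_mul_gaussPdf_comm hl1 hφ1 β β'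

lemma lintegral_dssPiST_mul_dssK {Θ l0 l1 φ0 φ1 : ℝ} (hΘ0 : 0 < Θ) (hΘ1 : Θ < 1) (hl0 : 0 < l0)
    (hl1 : 0 < l1) (hφ1 : |φ1| < 1) (β' : ℝ) :
    ∫⁻ β, ENNReal.ofReal (dssPiST Θ l0 l1 φ0 φ1 β) * ENNReal.ofReal (dssK Θ l0 l1 φ0 φ1 β' β) =
      ENNReal.ofReal (dssPiST Θ l0 l1 φ0 φ1 β') := by
  have hg : 0 ≤ Θ * psi1ST l1 φ0 φ1 β' := mul_nonneg hΘ0.le (gaussPdf_nonneg _ _ _)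
  have hl : 0 ≤ (1 - Θ) * laplacePdf l0 β' :=
    mul_nonneg (sub_pos.2 hΘ1).le (laplacePdf_nonneg hl0 β')
  have hsplit (β : ℝ) :
      ENNReal.ofReal (dssPiST Θ l0 l1 φ0 φ1 β) * ENNReal.ofReal (dssK Θ l0 l1 φ0 φ1 β' β) =
      ENNReal.ofReal (Θ * psi1ST l1 φ0 φ1 β') *
          ENNReal.ofReal (gaussPdf (φ0 + φ1 * (β' - φ0)) l1 β) +
        ENNReal.ofReal ((1 - Θ) * laplacePdf l0 β') * ENNReal.ofReal (laplacePdf l0 β) := by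
    rw [← ENNReal.ofReal_mul (dssPiST_pos hΘ0 hΘ1 hl0 l1 φ0 φ1 β).le,
      dssPiST_mul_dssK hΘ0 hΘ1 hl0 hl1 hφ1,
      ENNReal.ofReal_add (mul_nonneg hg (gaussPdf_nonneg _ _ _))
        (mul_nonneg hl (laplacePdf_nonneg hl0 β)),
      ENNReal.ofReal_mul hg, ENNReal.ofReal_mul hl]
  simp_rw [hsplit]
  rw [lintegral_add_left (by fun_prop), lintegral_const_mul _ (by fun_prop),
    lintegral_const_mul _ (by fun_prop), lintegral_gaussPdf _ hl1, lintegral_laplacePdf hl0,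
    mul_one, mul_one, ← ENNReal.ofReal_add hg hl, dssPiST]

/-- A density `f` that is invariant under the transition density `k x y` from `x` to `y` defines
an invariant measure. -/
lemma MeasureTheory.Measure.bind_withDensity_eq_of_lintegral_eq {α : Type*} [MeasurableSpace α]
    {ν : Measure α} [SFinite ν] {f : α → ENNReal} {k : α → α → ENNReal} (hf : Measurable f)
    (hk : Measurable (Function.uncurry k)) (h : ∀ y, ∫⁻ x, f x * k x y ∂ν = f y) :
    (ν.withDensity f).bind (fun x => ν.withDensity (k x)) = ν.withDensity f := by
  have hmeas : Measurable fun x => ν.withDensity (k x) := by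
    refine Measure.measurable_of_measurable_coe _ fun s hs => ?_
    simp_rw [withDensity_apply _ hs]
    exact hk.lintegral_prod_right'
  ext s hs
  rw [Measure.bind_apply hs hmeas.aemeasurable]
  simp_rw [withDensity_apply _ hs]
  have hks : Measurable fun x => ∫⁻ y in s, k x y ∂ν := hk.lintegral_prod_right'
  rw [lintegral_withDensity_eq_lintegral_mul _ hf hks]
  simp only [Pi.mul_apply]
  calc ∫⁻ x, f x * ∫⁻ y in s, k x y ∂ν ∂ν
      = ∫⁻ x, ∫⁻ y in s, f x * k x y ∂ν ∂ν :=
        lintegral_congr fun x => (lintegral_const_mul _ hk.of_uncurry_left).symm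
    _ = ∫⁻ y in s, ∫⁻ x, f x * k x y ∂ν ∂ν :=
        lintegral_lintegral_swap ((hf.comp measurable_fst).mul hk).aemeasurable
    _ = ∫⁻ y in s, f y ∂ν := by simp_rw [h]

/-- Theorem 1 (process form): if `μ t` is the marginal law at time `t` of a
time-homogeneous Markov chain on `ℝ` whose transitions have density
`K(β'|β)` w.r.t. Lebesgue measure and whose initial state has density `π^ST`,
then at every time `t` the marginal law has density `π^ST`
w.r.t. Lebesgue measure. -/
theorem dss_stationary_process
    (Θ l0 l1 φ0 φ1 : ℝ)
    (hΘ0 : 0 < Θ) (hΘ1 : Θ < 1) (hl0 : 0 < l0) (hl1 : 0 < l1) (hφ1 : |φ1| < 1)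
    (μ : ℕ → Measure ℝ)
    (h0 : μ 0 = volume.withDensity (fun β => ENNReal.ofReal (dssPiST Θ l0 l1 φ0 φ1 β)))
    (hstep : ∀ t : ℕ, μ (t + 1) =
      (μ t).bind (fun β =>
        volume.withDensity (fun β' => ENNReal.ofReal (dssK Θ l0 l1 φ0 φ1 β' β)))) :
    ∀ t : ℕ, μ t =
      volume.withDensity (fun β => ENNReal.ofReal (dssPiST Θ l0 l1 φ0 φ1 β)) := by
  intro t
  induction t with
  | zero => exact h0
  | succ t ih =>
    rw [hstep, ih]
    refine Measure.bind_withDensity_eq_of_lintegral_eq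
      (k := fun β β' => ENNReal.ofReal (dssK Θ l0 l1 φ0 φ1 β' β)) ?_ ?_
      (lintegral_dssPiST_mul_dssK hΘ0 hΘ1 hl0 hl1 hφ1)
    · simp only [dssPiST, psi1ST]
      fun_prop
    · simp only [Function.uncurry_def, dssK, mixW, psi1ST]
      fun_prop
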